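/- Let (X,d,m) be an isotropic PI space, E, F ⊆ X sets of finite perimeter, and B ⊆ X a Borel set. Then: (i) if P(E ∪ F, B) = P(E,B) + P(F,B), then H(∂^e E ∩ ∂^e F ∩ B) = 0; (ii) if m(E ∩ F) = 0 and H(∂^e E ∩ ∂^e F ∩ B) = 0, then P(E ∪ F, B) = P(E,B) + P(F,B). -/

import Mathlib

open MeasureTheory Metric Filter Set
open scoped ENNReal NNReal Topology

namespace PaperBV

noncomputable section

variable {X : Type*} [MetricSpace X]

/-- `f` is locally Lipschitz on `Ω`. -/
def LocLipOn (Ω : Set X) (f : X → ℝ) : Prop :=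
  ∀ x ∈ Ω, ∃ K : ℝ≥0, ∃ t ∈ 𝓝[Ω] x, LipschitzOnWith K f t

/-- The local Lipschitz constant (slope) `lip f` of a function, with value `0` at
points that are not accumulation points (there the filter `𝓝[≠] x` is trivial). -/
def lipConst (f : X → ℝ) (x : X) : ℝ≥0∞ :=
  Filter.limsup (fun y => ENNReal.ofReal (|f y - f x| / dist y x)) (𝓝[≠] x)

variable [MeasurableSpace X]

/-- Convergence `fn → f` in `L¹_loc(μ⌊Ω)`. -/
def TendstoL1loc (μ : Measure X) (Ω : Set X) (fn : ℕ → X → ℝ) (f : X → ℝ) : Prop :=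
  ∀ K : Set X, IsCompact K → K ⊆ Ω →
    Filter.Tendsto (fun n => ∫⁻ x in K, ENNReal.ofReal |fn n x - f x| ∂μ)
      Filter.atTop (𝓝 0)

/-- The total variation `|Df|(Ω)` of `f` on an open set `Ω`, defined by relaxation of the
integral of the local Lipschitz constant along locally Lipschitz approximations. -/
def tvOpen (μ : Measure X) (f : X → ℝ) (Ω : Set X) : ℝ≥0∞ :=
  sInf { a : ℝ≥0∞ | ∃ fn : ℕ → X → ℝ, (∀ n, LocLipOn Ω (fn n)) ∧ TendstoL1loc μ Ω fn f ∧
    a = Filter.liminf (fun n => ∫⁻ x in Ω, lipConst (fn n) x ∂μ) Filter.atTop }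

/-- The total variation measure `|Df|(B)` of `f` on an arbitrary set, obtained from the
values on open sets by the Carathéodory construction. -/
def tv (μ : Measure X) (f : X → ℝ) (B : Set X) : ℝ≥0∞ :=
  ⨅ (Ω : Set X) (_ : IsOpen Ω) (_ : B ⊆ Ω), tvOpen μ f Ω

/-- `f` is a function of bounded variation: `f ∈ L¹(μ)` and `|Df|(X) < ∞`. -/
def BVFun (μ : Measure X) (f : X → ℝ) : Prop :=
  MeasureTheory.Integrable f μ ∧ tv μ f Set.univ < ⊤

/-- The perimeter `P(E, B) = |D 1_E|(B)`. -/
def perim (μ : Measure X) (E B : Set X) : ℝ≥0∞ :=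
  tv μ (E.indicator fun _ => (1 : ℝ)) B

/-- `E` is a (Borel) set of finite perimeter. -/
def FinPerim (μ : Measure X) (E : Set X) : Prop :=
  MeasurableSet E ∧ perim μ E Set.univ < ⊤

/-- `μ` is a doubling measure with doubling constant `CD`. -/
def Doubling (μ : Measure X) (CD : ℝ≥0) : Prop :=
  1 ≤ CD ∧ ∀ (x : X) (r : ℝ), 0 < r → μ (ball x (2 * r)) ≤ (CD : ℝ≥0∞) * μ (ball x r)

/-- The mean value `f_{x,r}` of `f` on the ball `B_r(x)`. -/
def ballAvg (μ : Measure X) (f : X → ℝ) (x : X) (r : ℝ) : ℝ :=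
  (∫ y in ball x r, f y ∂μ) / (μ (ball x r)).toReal

/-- The weak `(1,1)`-Poincaré inequality with constants `CP`, `lam`,
for locally Lipschitz functions. -/
def WeakPoincare (μ : Measure X) (CP lam : ℝ) : Prop :=
  ∀ f : X → ℝ, LocLipOn Set.univ f → ∀ (x : X) (r : ℝ), 0 < r →
    ∫⁻ y in ball x r, ENNReal.ofReal |f y - ballAvg μ f x r| ∂μ ≤
      ENNReal.ofReal (CP * r) * ∫⁻ y in ball x (lam * r), lipConst f y ∂μ

/-- A PI space: doubling and supporting a weak `(1,1)`-Poincaré inequality. -/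
def IsPI (μ : Measure X) : Prop :=
  ∃ (CD : ℝ≥0) (CP lam : ℝ), Doubling μ CD ∧ 0 < CP ∧ 1 ≤ lam ∧ WeakPoincare μ CP lam

/-- The pre-measure `H_δ` of the codimension-one Hausdorff measure: infimum over countable
covers by balls of radii at most `δ` of `∑ μ(B_{r_i}(x_i)) / (2 r_i)`. -/
def preH (μ : Measure X) (δ : ℝ) (S : Set X) : ℝ≥0∞ :=
  ⨅ (c : ℕ → X × ℝ) (_ : ∀ i, 0 < (c i).2 ∧ (c i).2 ≤ δ)
    (_ : S ⊆ ⋃ i, ball (c i).1 (c i).2),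
    ∑' i, μ (ball (c i).1 (c i).2) / ENNReal.ofReal (2 * (c i).2)

/-- The codimension-one Hausdorff measure `H = lim_{δ ↓ 0} H_δ = sup_{δ > 0} H_δ`
(as an outer-measure-type set function). -/
def codimH (μ : Measure X) (S : Set X) : ℝ≥0∞ :=
  ⨆ (δ : ℝ) (_ : 0 < δ), preH μ δ S

/-- The upper density of `E` at `x`. -/
def upperDens (μ : Measure X) (E : Set X) (x : X) : ℝ≥0∞ :=
  Filter.limsup (fun r : ℝ => μ (E ∩ ball x r) / μ (ball x r)) (𝓝[>] (0 : ℝ))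

/-- The essential boundary `∂^e E`. -/
def essBdry (μ : Measure X) (E : Set X) : Set X :=
  {x | 0 < upperDens μ E x ∧ 0 < upperDens μ Eᶜ x}

/-- The essential interior `E^1`: points of density `1`. -/
def essInt (μ : Measure X) (E : Set X) : Set X :=
  {x | Filter.Tendsto (fun r : ℝ => μ (E ∩ ball x r) / μ (ball x r))
    (𝓝[>] (0 : ℝ)) (𝓝 (1 : ℝ≥0∞))}

/-- Integral `∫_S f dν` with respect to an outer-measure-type set function `ν`,
via the layer-cake formula. -/
def outerLint (ν : Set X → ℝ≥0∞) (S : Set X) (f : X → ℝ≥0∞) : ℝ≥0∞ :=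
  ∫⁻ t in Set.Ioi (0 : ℝ), ν {x ∈ S | ENNReal.ofReal t < f x}

/-- `θ` is a family of densities representing the perimeter measures with respect to the
codimension-one Hausdorff measure: `P(E,B) = ∫_{B ∩ ∂^e E} θ_E dH`, with
`γ ≤ θ_E ≤ C` on `∂^e E` for structural constants `0 < γ`, `C < ∞`. -/
def PerimRepr (μ : Measure X) (θ : Set X → X → ℝ≥0∞) : Prop :=
  ∃ γ C : ℝ≥0∞, 0 < γ ∧ C ≠ ⊤ ∧
    ∀ E : Set X, FinPerim μ E →
      (∀ x ∈ essBdry μ E, γ ≤ θ E x ∧ θ E x ≤ C) ∧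
      ∀ B : Set X, MeasurableSet B →
        perim μ E B = outerLint (codimH μ) (B ∩ essBdry μ E) (θ E)

/-- The space is isotropic: the densities `θ_E` can be chosen so that, whenever `F ⊆ E` are
sets of finite perimeter, `θ_F = θ_E` holds `H`-a.e. on `∂^e F ∩ ∂^e E`. -/
def Isotropic (μ : Measure X) : Prop :=
  ∃ θ : Set X → X → ℝ≥0∞, PerimRepr μ θ ∧
    ∀ E F : Set X, FinPerim μ E → FinPerim μ F → F ⊆ E →
      codimH μ {x ∈ essBdry μ F ∩ essBdry μ E | θ F x ≠ θ E x} = 0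

/-- Property (1.2): `H(∂^e E ∩ ∂^e F ∩ ∂^e (E ∪ F)) = 0` for disjoint sets of finite
perimeter. -/
def Prop12 (μ : Measure X) : Prop :=
  ∀ E F : Set X, FinPerim μ E → FinPerim μ F → Disjoint E F →
    codimH μ (essBdry μ E ∩ essBdry μ F ∩ essBdry μ (E ∪ F)) = 0

/-- `E` is decomposable in `B`: `E ∩ B` admits a partition into two sets of finite perimeter
and positive measure such that the perimeter in `B` is additive. -/
def DecomposableIn (μ : Measure X) (E B : Set X) : Prop :=
  ∃ F G : Set X, FinPerim μ F ∧ FinPerim μ G ∧ Disjoint F G ∧ F ∪ G = E ∩ B ∧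
    0 < μ F ∧ 0 < μ G ∧ perim μ E B = perim μ F B + perim μ G B

/-- `E` is a set of finite perimeter which is indecomposable in `B`. -/
def IndecomposableIn (μ : Measure X) (E B : Set X) : Prop :=
  FinPerim μ E ∧ ¬ DecomposableIn μ E B

/-- `E` is an indecomposable set (of finite perimeter). -/
def Indecomposable (μ : Measure X) (E : Set X) : Prop :=
  IndecomposableIn μ E Set.univ

/-- `E` is a simple set. -/
def SimpleSet (μ : Measure X) (E : Set X) : Prop :=
  FinPerim μ E ∧ μ E < ⊤ ∧
  ∀ F : Set X, FinPerim μ F → codimH μ (essBdry μ F \ essBdry μ E) = 0 →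
    μ F = 0 ∨ μ Fᶜ = 0 ∨ μ (symmDiff F E) = 0 ∨ μ (symmDiff F Eᶜ) = 0

end

theorem ennreal_limsup_add_le {α : Type*} (l : Filter α) (u v : α → ℝ≥0∞) :
    limsup (fun x => u x + v x) l ≤ limsup u l + limsup v l := by
  refine ENNReal.le_of_forall_pos_le_add fun ε hε hfin => ?_
  obtain ⟨hu, hv⟩ := ENNReal.add_lt_top.1 hfin
  have hε' : ((ε / 2 : ℝ≥0) : ℝ≥0∞) ≠ 0 := by positivity
  refine limsup_le_of_le (by isBoundedDefault) ?_
  filter_upwards [eventually_lt_of_limsup_lt (ENNReal.lt_add_right hu.ne hε'),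
    eventually_lt_of_limsup_lt (ENNReal.lt_add_right hv.ne hε')] with x hxu hxv
  refine (add_le_add hxu.le hxv.le).trans (le_of_eq ?_)
  rw [add_add_add_comm, ← ENNReal.coe_add, add_halves]

section CodimensionOneMeasure

variable {X : Type*} [MetricSpace X] [MeasurableSpace X] {μ : Measure X}

theorem preH_mono {δ : ℝ} {S T : Set X} (h : S ⊆ T) : preH μ δ S ≤ preH μ δ T :=
  iInf_mono fun _ => iInf_mono fun _ => iInf_mono' fun hT => ⟨h.trans hT, le_rfl⟩

theorem preH_anti {δ δ' : ℝ} (h : δ ≤ δ') (S : Set X) : preH μ δ' S ≤ preH μ δ S :=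
  iInf_mono fun _ => iInf_mono' fun hc => ⟨fun i => ⟨(hc i).1, (hc i).2.trans h⟩, le_rfl⟩

theorem preH_le_codimH {δ : ℝ} (hδ : 0 < δ) (S : Set X) : preH μ δ S ≤ codimH μ S :=
  le_iSup₂_of_le δ hδ le_rfl

theorem codimH_mono {S T : Set X} (h : S ⊆ T) : codimH μ S ≤ codimH μ T :=
  iSup₂_mono fun _ _ => preH_mono h

theorem preH_le_tsum {δ : ℝ} {S : Set X} (c : ℕ → X × ℝ)
    (hc : ∀ i, 0 < (c i).2 ∧ (c i).2 ≤ δ) (hS : S ⊆ ⋃ i, ball (c i).1 (c i).2) :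
    preH μ δ S ≤ ∑' i, μ (ball (c i).1 (c i).2) / ENNReal.ofReal (2 * (c i).2) :=
  iInf_le_of_le c (iInf₂_le_of_le hc hS le_rfl)

theorem exists_cover_of_preH_lt {δ : ℝ} {S : Set X} {a : ℝ≥0∞} (h : preH μ δ S < a) :
    ∃ c : ℕ → X × ℝ, (∀ i, 0 < (c i).2 ∧ (c i).2 ≤ δ) ∧ S ⊆ ⋃ i, ball (c i).1 (c i).2 ∧
      ∑' i, μ (ball (c i).1 (c i).2) / ENNReal.ofReal (2 * (c i).2) < a := by
  simp only [preH, iInf_lt_iff] at h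
  obtain ⟨c, hc, hS, hlt⟩ := h
  exact ⟨c, hc, hS, hlt⟩

theorem preH_iUnion_le (δ : ℝ) (S : ℕ → Set X) :
    preH μ δ (⋃ n, S n) ≤ ∑' n, preH μ δ (S n) := by
  refine ENNReal.le_of_forall_pos_le_add fun ε hε hfin => ?_
  obtain ⟨η, hη, hsum⟩ := ENNReal.exists_pos_sum_of_countable'
    (ENNReal.coe_pos.2 hε).ne' ℕ
  have hcov (n : ℕ) := exists_cover_of_preH_lt
    (ENNReal.lt_add_right (ENNReal.ne_top_of_tsum_ne_top hfin.ne n) (hη n).ne')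
  choose c hc hS hlt using hcov
  let e := Nat.pairEquiv.symm
  calc preH μ δ (⋃ n, S n)
      ≤ ∑' i, μ (ball (c (e i).1 (e i).2).1 (c (e i).1 (e i).2).2) /
          ENNReal.ofReal (2 * (c (e i).1 (e i).2).2) := by
        refine preH_le_tsum (fun i => c (e i).1 (e i).2) (fun i => hc _ _) ?_
        refine iUnion_subset fun n x hx => ?_
        obtain ⟨k, hk⟩ := mem_iUnion.1 (hS n hx)
        exact mem_iUnion.2 ⟨e.symm (n, k), by simpa using hk⟩
    _ = ∑' p : ℕ × ℕ, μ (ball (c p.1 p.2).1 (c p.1 p.2).2) /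
          ENNReal.ofReal (2 * (c p.1 p.2).2) :=
        e.tsum_eq fun p : ℕ × ℕ => μ (ball (c p.1 p.2).1 (c p.1 p.2).2) /
          ENNReal.ofReal (2 * (c p.1 p.2).2)
    _ = ∑' n, ∑' k, μ (ball (c n k).1 (c n k).2) / ENNReal.ofReal (2 * (c n k).2) :=
        ENNReal.tsum_prod (f := fun n k => μ (ball (c n k).1 (c n k).2) /
          ENNReal.ofReal (2 * (c n k).2))
    _ ≤ ∑' n, (preH μ δ (S n) + η n) := ENNReal.tsum_le_tsum fun n => (hlt n).le
    _ ≤ ∑' n, preH μ δ (S n) + ε := by rw [ENNReal.tsum_add]; gcongr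

/-- `codimH μ` as an outer measure. Since covers consist of infinitely many nonempty balls,
the vanishing on the empty set is a hypothesis. -/
noncomputable def codimHOuter (μ : Measure X) (h0 : codimH μ ∅ = 0) : OuterMeasure X where
  measureOf := codimH μ
  empty := h0
  mono := codimH_mono
  iUnion_nat S _ := iSup₂_le fun δ hδ => (preH_iUnion_le δ S).trans
    (ENNReal.tsum_le_tsum fun n => preH_le_codimH hδ (S n))

theorem preH_add_le_of_separated (h0 : codimH μ ∅ = 0) {δ : ℝ} (hδ : 0 < δ) {S T : Set X}
    (hsep : ∀ x ∈ S, ∀ y ∈ T, 2 * δ ≤ dist x y) :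
    preH μ δ S + preH μ δ T ≤ preH μ δ (S ∪ T) := by
  classical
  refine ENNReal.le_of_forall_pos_le_add fun ε hε hfin => ?_
  obtain ⟨c, hc, hST, hlt⟩ := exists_cover_of_preH_lt
    (ENNReal.lt_add_right hfin.ne (show ((ε / 3 : ℝ≥0) : ℝ≥0∞) ≠ 0 by positivity))
  obtain ⟨e, he, -, helt⟩ := exists_cover_of_preH_lt (μ := μ) (δ := δ) (S := ∅)
    (a := ((ε / 3 : ℝ≥0) : ℝ≥0∞))
    (((preH_le_codimH hδ ∅).trans h0.le).trans_lt (by positivity))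
  let w : X × ℝ → ℝ≥0∞ := fun p => μ (ball p.1 p.2) / ENNReal.ofReal (2 * p.2)
  let meets : Set X → ℕ → Prop := fun A i => (A ∩ ball (c i).1 (c i).2).Nonempty
  have key (A : Set X) (hA : A ⊆ S ∪ T) :
      preH μ δ A ≤ ∑' i, (if meets A i then w (c i) else 0) + (ε / 3 : ℝ≥0) := by
    calc preH μ δ A ≤ ∑' i, w (if meets A i then c i else e i) := by
          refine preH_le_tsum (fun i => if meets A i then c i else e i) (fun i => ?_) ?_
          · split_ifs
            exacts [hc i, he i]
          · intro x hx
            obtain ⟨i, hi⟩ := mem_iUnion.1 (hST (hA hx))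
            refine mem_iUnion.2 ⟨i, ?_⟩
            rw [if_pos (show meets A i from ⟨x, hx, hi⟩)]
            exact hi
      _ ≤ ∑' i, ((if meets A i then w (c i) else 0) + w (e i)) := by
          refine ENNReal.tsum_le_tsum fun i => ?_
          split_ifs
          · exact le_self_add
          · exact le_add_self
      _ ≤ _ := by rw [ENNReal.tsum_add]; gcongr
  have hdisj (i : ℕ) : (if meets S i then w (c i) else 0) + (if meets T i then w (c i) else 0)
      ≤ w (c i) := by
    by_cases hS : meets S i
    · have hT : ¬ meets T i := by
        rintro ⟨y, hyT, hy⟩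
        obtain ⟨x, hxS, hx⟩ := hS
        have h1 := hsep x hxS y hyT
        have h2 := dist_triangle_right x y (c i).1
        have h3 := (hc i).2
        rw [mem_ball] at hx hy
        linarith
      simp [hS, hT]
    · simp only [hS, if_false, zero_add]
      split_ifs <;> simp
  calc preH μ δ S + preH μ δ T
      ≤ (∑' i, (if meets S i then w (c i) else 0) + (ε / 3 : ℝ≥0)) +
        (∑' i, (if meets T i then w (c i) else 0) + (ε / 3 : ℝ≥0)) :=
        add_le_add (key S subset_union_left) (key T subset_union_right)
    _ = ∑' i, ((if meets S i then w (c i) else 0) + (if meets T i then w (c i) else 0)) +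
        ((ε / 3 : ℝ≥0) + (ε / 3 : ℝ≥0)) := by rw [ENNReal.tsum_add]; ring
    _ ≤ (preH μ δ (S ∪ T) + (ε / 3 : ℝ≥0)) + ((ε / 3 : ℝ≥0) + (ε / 3 : ℝ≥0)) := by
        gcongr
        exact (ENNReal.tsum_le_tsum hdisj).trans hlt.le
    _ = preH μ δ (S ∪ T) + ε := by
        rw [add_assoc]
        congr 1
        norm_cast
        rw [← add_assoc, add_thirds]

theorem codimHOuter_isMetric (h0 : codimH μ ∅ = 0) : (codimHOuter μ h0).IsMetric := by
  rintro S T ⟨r, hr0, hr⟩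
  refine le_antisymm (measure_union_le _ _) ?_
  obtain ⟨ρ, hρ0, hρr⟩ := ENNReal.lt_iff_exists_nnreal_btwn.1 (pos_iff_ne_zero.2 hr0)
  have hρ : (0 : ℝ) < ρ := by exact_mod_cast hρ0
  refine ENNReal.biSup_add_biSup_le' ⟨1, one_pos⟩ ⟨1, one_pos⟩ fun δ hδ δ' hδ' => ?_
  have hpos : 0 < min (min δ δ') (ρ / 2) := lt_min (lt_min hδ hδ') (by positivity)
  refine le_trans ?_ (preH_le_codimH hpos (S ∪ T))
  refine le_trans (add_le_add (preH_anti ?_ S) (preH_anti ?_ T))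
    (preH_add_le_of_separated h0 hpos fun x hx y hy => ?_)
  · exact (min_le_left _ _).trans (min_le_left _ _)
  · exact (min_le_left _ _).trans (min_le_right _ _)
  · have h1 : (ρ : ℝ≥0∞) ≤ edist x y := hρr.le.trans (hr x hx y hy)
    have h2 : (ρ : ℝ) ≤ dist x y := by
      rw [edist_nndist] at h1
      exact_mod_cast h1
    linarith [min_le_right (min δ δ') ((ρ : ℝ) / 2)]

theorem codimH_inter_add_diff [BorelSpace X] (h0 : codimH μ ∅ = 0) {A : Set X}
    (hA : MeasurableSet A) (S : Set X) :
    codimH μ S = codimH μ (S ∩ A) + codimH μ (S \ A) :=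
  (OuterMeasure.isCaratheodory_iff (codimHOuter μ h0)).1
    ((codimHOuter_isMetric h0).borel_le_caratheodory A
      ((BorelSpace.measurable_eq (α := X)) ▸ hA)) S

end CodimensionOneMeasure

section OuterIntegral

variable {X : Type*}

theorem outerLint_le_of_null_diff [MeasurableSpace X] (ν : OuterMeasure X) {S T : Set X}
    {f g : X → ℝ≥0∞} (h : ν {x ∈ S | ¬ (x ∈ T ∧ f x = g x)} = 0) :
    outerLint ν S f ≤ outerLint ν T g := by
  refine lintegral_mono fun t => ?_
  calc ν {x ∈ S | ENNReal.ofReal t < f x}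
      ≤ ν ({x ∈ T | ENNReal.ofReal t < g x} ∪ {x ∈ S | ¬ (x ∈ T ∧ f x = g x)}) := by
        refine measure_mono fun x hx => ?_
        by_cases hxT : x ∈ T ∧ f x = g x
        · exact Or.inl ⟨hxT.1, hxT.2 ▸ hx.2⟩
        · exact Or.inr ⟨hx.1, hxT⟩
    _ ≤ _ := (measure_union_le _ _).trans (by rw [h, add_zero])

theorem outerLint_inter_add_diff [MeasurableSpace X] (ν : OuterMeasure X) {A : Set X}
    (hA : ∀ S, ν S = ν (S ∩ A) + ν (S \ A)) (S : Set X) (f : X → ℝ≥0∞) :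
    outerLint ν S f = outerLint ν (S ∩ A) f + outerLint ν (S \ A) f := by
  have hanti : Antitone fun t : ℝ => ν {x ∈ S ∩ A | ENNReal.ofReal t < f x} :=
    fun s t hst => measure_mono fun x hx =>
      ⟨hx.1, (ENNReal.ofReal_le_ofReal hst).trans_lt hx.2⟩
  rw [outerLint, outerLint, outerLint, ← lintegral_add_left hanti.measurable]
  refine lintegral_congr fun t => ?_
  rw [hA]
  congr 2 <;> ext x <;> simp only [mem_inter_iff, Set.mem_sdiff, mem_ofPred_eq] <;> tauto

theorem eq_zero_of_outerLint_eq_zero [MeasurableSpace X] (ν : Set X → ℝ≥0∞) {S : Set X}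
    {f : X → ℝ≥0∞} {γ : ℝ≥0∞} (hγ : 0 < γ) (hf : ∀ x ∈ S, γ ≤ f x)
    (h : outerLint ν S f = 0) : ν S = 0 := by
  obtain ⟨ρ, hρ0, hργ⟩ := ENNReal.lt_iff_exists_nnreal_btwn.1 hγ
  have hρ : (0 : ℝ) < ρ := by exact_mod_cast hρ0
  have hle : ν S * ENNReal.ofReal ρ ≤ outerLint ν S f := by
    calc ν S * ENNReal.ofReal ρ = ∫⁻ _ in Ioo (0 : ℝ) ρ, ν S := by simp
      _ = ∫⁻ t in Ioo (0 : ℝ) ρ, ν {x ∈ S | ENNReal.ofReal t < f x} := by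
          refine setLIntegral_congr_fun measurableSet_Ioo fun t ht => ?_
          congr 1
          refine (sep_eq_self_iff_mem_true.2 fun x hx => ?_).symm
          refine lt_of_lt_of_le ?_ (hργ.le.trans (hf x hx))
          rw [← ENNReal.ofReal_coe_nnreal]
          exact (ENNReal.ofReal_lt_ofReal_iff hρ).2 ht.2
      _ ≤ outerLint ν S f := lintegral_mono_set Ioo_subset_Ioi_self
  rw [h, nonpos_iff_eq_zero, mul_eq_zero] at hle
  exact hle.resolve_right (by simpa using hρ0.ne')

end OuterIntegral

section Density

variable {X : Type*} [MetricSpace X] [MeasurableSpace X] {μ : Measure X}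

theorem upperDens_mono {E F : Set X} (h : μ (E \ F) = 0) (x : X) :
    upperDens μ E x ≤ upperDens μ F x := by
  refine limsup_le_limsup (Eventually.of_forall fun r => ?_)
  dsimp only
  gcongr ?_ / _
  calc μ (E ∩ ball x r) ≤ μ ((F ∩ ball x r) ∪ (E \ F)) := by
        refine measure_mono fun y hy => ?_
        by_cases hyF : y ∈ F
        · exact Or.inl ⟨hyF, hy.2⟩
        · exact Or.inr ⟨hy.1, hyF⟩
    _ ≤ _ := (measure_union_le _ _).trans (by rw [h, add_zero])

theorem upperDens_union_le (E F : Set X) (x : X) :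
    upperDens μ (E ∪ F) x ≤ upperDens μ E x + upperDens μ F x := by
  refine le_trans (limsup_le_limsup (Eventually.of_forall fun r => ?_))
    (ennreal_limsup_add_le _ _ _)
  dsimp only
  rw [← ENNReal.add_div, union_inter_distrib_right]
  gcongr
  exact measure_union_le _ _

theorem upperDens_mono_set {E F : Set X} (h : E ⊆ F) (x : X) :
    upperDens μ E x ≤ upperDens μ F x :=
  upperDens_mono (by rw [sdiff_eq_empty.2 h, measure_empty]) x

theorem essBdry_union_subset (E F : Set X) :
    essBdry μ (E ∪ F) ⊆ essBdry μ E ∪ essBdry μ F := by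
  rintro x ⟨h1, h2⟩
  have h3 := h1.trans_le (upperDens_union_le E F x)
  rcases eq_or_ne (upperDens μ E x) 0 with hE | hE
  · rw [hE, zero_add] at h3
    exact Or.inr ⟨h3, h2.trans_le
      (upperDens_mono_set (compl_subset_compl.2 subset_union_right) x)⟩
  · exact Or.inl ⟨pos_iff_ne_zero.2 hE, h2.trans_le
      (upperDens_mono_set (compl_subset_compl.2 subset_union_left) x)⟩

theorem essBdry_diff_subset_essBdry_union {E F : Set X} (h : μ (E ∩ F) = 0) :
    essBdry μ E \ essBdry μ F ⊆ essBdry μ (E ∪ F) := by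
  rintro x ⟨⟨h1, h2⟩, h3⟩
  have hFc : 0 < upperDens μ Fᶜ x :=
    h1.trans_le (upperDens_mono (by rwa [sdiff_compl]) x)
  have hF : upperDens μ F x = 0 := by
    by_contra hF
    exact h3 ⟨pos_iff_ne_zero.2 hF, hFc⟩
  refine ⟨h1.trans_le (upperDens_mono_set subset_union_left x), ?_⟩
  have h4 : upperDens μ Eᶜ x ≤ upperDens μ ((E ∪ F)ᶜ ∪ F) x := by
    refine upperDens_mono_set (fun y hy => ?_) x
    by_cases hyF : y ∈ F
    · exact Or.inr hyF
    · exact Or.inl fun hy' => hy'.elim hy hyF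
  have h5 := h2.trans_le (h4.trans (upperDens_union_le _ _ x))
  rwa [hF, add_zero] at h5

theorem measurable_measure_inter_ball [BorelSpace X] (E : Set X) (r : ℝ) :
    Measurable fun x => μ (E ∩ ball x r) := by
  refine LowerSemicontinuous.measurable fun x a ha => ?_
  have hU : E ∩ ball x r = ⋃ n : ℕ, E ∩ ball x (r - 1 / (n + 1)) := by
    rw [← inter_iUnion]
    congr 1
    ext y
    simp only [mem_iUnion, mem_ball]
    refine ⟨fun hy => ?_, fun ⟨n, hn⟩ => hn.trans (sub_lt_self _ Nat.one_div_pos_of_nat)⟩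
    obtain ⟨n, hn⟩ := exists_nat_one_div_lt (sub_pos.2 hy)
    exact ⟨n, by linarith⟩
  have hmono : Monotone fun n : ℕ => E ∩ ball x (r - 1 / ((n : ℝ) + 1)) := fun m n hmn =>
    inter_subset_inter_right _ (ball_subset_ball
      (sub_le_sub_left (Nat.one_div_le_one_div hmn) r))
  dsimp only at ha
  rw [hU, hmono.measure_iUnion, gt_iff_lt, lt_iSup_iff] at ha
  obtain ⟨n, hn⟩ := ha
  filter_upwards [ball_mem_nhds x (Nat.one_div_pos_of_nat (α := ℝ) (n := n))] with y hy
  refine hn.trans_le (measure_mono (inter_subset_inter_right _ (ball_subset_ball' ?_)))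
  rw [mem_ball, dist_comm] at hy
  linarith

theorem ball_measure_ne_zero {CD : ℝ≥0} (hD : Doubling μ CD) (hμ : μ ≠ 0) (x : X) {r : ℝ}
    (hr : 0 < r) : μ (ball x r) ≠ 0 := by
  intro h
  have hn (n : ℕ) : μ (ball x (2 ^ n * r)) = 0 := by
    induction n with
    | zero => simpa using h
    | succ n ih =>
      have := hD.2 x (2 ^ n * r) (by positivity)
      rw [ih, mul_zero, nonpos_iff_eq_zero] at this
      rwa [pow_succ', mul_assoc]
  refine hμ (Measure.measure_univ_eq_zero.1 ?_)
  refine measure_mono_null (fun y _ => ?_) (measure_iUnion_null hn)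
  obtain ⟨n, hn⟩ := pow_unbounded_of_one_lt (dist y x / r) one_lt_two
  exact mem_iUnion.2 ⟨n, by rwa [mem_ball, ← div_lt_iff₀ hr]⟩

theorem ball_measure_ne_top [IsLocallyFiniteMeasure μ] {CD : ℝ≥0} (hD : Doubling μ CD)
    (x : X) (r : ℝ) : μ (ball x r) ≠ ⊤ := by
  obtain ⟨s, hs, hfin⟩ := nhds_basis_ball.mem_iff.1
    (IsLocallyFiniteMeasure.finiteAtNhds (μ := μ) x).choose_spec.1
  have hfin' : μ (ball x s) ≠ ⊤ := ((measure_mono hfin).trans_lt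
    (IsLocallyFiniteMeasure.finiteAtNhds (μ := μ) x).choose_spec.2).ne
  have hn (n : ℕ) : μ (ball x (2 ^ n * s)) ≠ ⊤ := by
    induction n with
    | zero => simpa using hfin'
    | succ n ih =>
      rw [pow_succ', mul_assoc]
      exact ne_top_of_le_ne_top (ENNReal.mul_ne_top ENNReal.coe_ne_top ih)
        (hD.2 x (2 ^ n * s) (by positivity))
  obtain ⟨n, hn'⟩ := pow_unbounded_of_one_lt (r / s) one_lt_two
  exact ne_top_of_le_ne_top (hn n)
    (measure_mono (ball_subset_ball ((div_le_iff₀ hs).1 hn'.le)))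

/-- The upper density along the radii `2⁻ⁿ`. -/
noncomputable def dyadicUpperDens (μ : Measure X) (E : Set X) (x : X) : ℝ≥0∞ :=
  limsup (fun n : ℕ => μ (E ∩ ball x ((1 / 2) ^ n)) / μ (ball x ((1 / 2) ^ n))) atTop

theorem measurable_dyadicUpperDens [BorelSpace X] (E : Set X) :
    Measurable (dyadicUpperDens μ E) := by
  refine Measurable.limsup fun n => (measurable_measure_inter_ball E _).div ?_
  simpa using measurable_measure_inter_ball (μ := μ) univ ((1 / 2) ^ n)

theorem dyadicUpperDens_le_upperDens (E : Set X) (x : X) :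
    dyadicUpperDens μ E x ≤ upperDens μ E x := by
  have ht : Tendsto (fun n : ℕ => (1 / 2 : ℝ) ^ n) atTop (𝓝[>] 0) :=
    tendsto_pow_atTop_nhdsWithin_zero_of_lt_one (by norm_num) (by norm_num)
  exact ht.limsup_comp_le_limsup
    (u := fun r : ℝ => μ (E ∩ ball x r) / μ (ball x r))

theorem upperDens_le_mul_dyadicUpperDens [IsLocallyFiniteMeasure μ] {CD : ℝ≥0}
    (hD : Doubling μ CD) (hμ : μ ≠ 0) (E : Set X) (x : X) :
    upperDens μ E x ≤ CD * dyadicUpperDens μ E x := by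
  rw [dyadicUpperDens, ← ENNReal.limsup_const_mul_of_ne_top ENNReal.coe_ne_top]
  refine le_of_forall_gt_imp_ge_of_dense fun a ha => ?_
  obtain ⟨N, hN⟩ := eventually_atTop.1 (eventually_lt_of_limsup_lt ha)
  refine limsup_le_of_le (by isBoundedDefault) ?_
  filter_upwards [Ioo_mem_nhdsGT (show (0 : ℝ) < (1 / 2) ^ N by positivity)] with r hr
  obtain ⟨n, hn1, hn2⟩ := exists_nat_pow_near_of_lt_one hr.1
    (hr.2.le.trans (pow_le_one₀ (by norm_num) (by norm_num))) (y := (1 / 2 : ℝ))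
    (by norm_num) (by norm_num)
  have hNn : N ≤ n := by
    by_contra hlt
    have : (1 / 2 : ℝ) ^ N ≤ (1 / 2) ^ (n + 1) :=
      pow_le_pow_of_le_one (by norm_num) (by norm_num) (by omega)
    linarith [hr.2]
  refine le_trans ?_ (hN n hNn).le
  have hdoub : μ (ball x ((1 / 2) ^ n)) ≤ CD * μ (ball x r) := by
    refine le_trans (measure_mono (ball_subset_ball ?_)) (hD.2 x r hr.1)
    rw [pow_succ] at hn1
    linarith
  have h0 := ball_measure_ne_zero hD hμ x hr.1
  have hp : (0 : ℝ) < (1 / 2) ^ n := by positivity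
  rw [ENNReal.div_le_iff h0 (ball_measure_ne_top hD x r)]
  calc μ (E ∩ ball x r) ≤ μ (E ∩ ball x ((1 / 2) ^ n)) := by gcongr
    _ = μ (E ∩ ball x ((1 / 2) ^ n)) / μ (ball x ((1 / 2) ^ n)) * μ (ball x ((1 / 2) ^ n)) :=
        (ENNReal.div_mul_cancel (ball_measure_ne_zero hD hμ x hp)
          (ball_measure_ne_top hD x _)).symm
    _ ≤ μ (E ∩ ball x ((1 / 2) ^ n)) / μ (ball x ((1 / 2) ^ n)) * (CD * μ (ball x r)) := by
        gcongr
    _ = _ := by ring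

theorem measurableSet_essBdry [BorelSpace X] [IsLocallyFiniteMeasure μ] {CD : ℝ≥0}
    (hD : Doubling μ CD) (hμ : μ ≠ 0) (E : Set X) : MeasurableSet (essBdry μ E) := by
  have hiff (A : Set X) (x : X) : 0 < upperDens μ A x ↔ 0 < dyadicUpperDens μ A x := by
    refine ⟨fun h => ?_, fun h => h.trans_le (dyadicUpperDens_le_upperDens A x)⟩
    have := h.trans_le (upperDens_le_mul_dyadicUpperDens hD hμ A x)
    exact pos_iff_ne_zero.2 (right_ne_zero_of_mul this.ne')
  simp only [essBdry, hiff]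
  exact (measurableSet_lt measurable_const (measurable_dyadicUpperDens E)).inter
    (measurableSet_lt measurable_const (measurable_dyadicUpperDens Eᶜ))

end Density

section Perimeter

variable {X : Type*} [MetricSpace X]

theorem LocLipOn.continuous {f : X → ℝ} (hf : LocLipOn univ f) : Continuous f := by
  refine continuous_iff_continuousAt.2 fun x => ?_
  obtain ⟨K, t, ht, hK⟩ := hf x (mem_univ x)
  rw [nhdsWithin_univ] at ht
  exact hK.continuousOn.continuousAt ht

theorem LocLipOn.max {Ω : Set X} {f g : X → ℝ} (hf : LocLipOn Ω f) (hg : LocLipOn Ω g) :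
    LocLipOn Ω fun x => max (f x) (g x) := by
  intro x hx
  obtain ⟨K, s, hs, hK⟩ := hf x hx
  obtain ⟨L, t, ht, hL⟩ := hg x hx
  refine ⟨Max.max K L, s ∩ t, inter_mem hs ht, LipschitzOnWith.of_dist_le_mul
    fun y hy z hz => (abs_max_sub_max_le_max _ _ _ _).trans (max_le ?_ ?_)⟩
  · refine (hK.dist_le_mul y hy.1 z hz.1).trans ?_
    gcongr
    exact le_max_left _ _
  · refine (hL.dist_le_mul y hy.2 z hz.2).trans ?_
    gcongr
    exact le_max_right _ _

theorem lipConst_max_le (f g : X → ℝ) (x : X) :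
    lipConst (fun y => max (f y) (g y)) x ≤ lipConst f x + lipConst g x := by
  refine le_trans (limsup_le_limsup (Eventually.of_forall fun y => ?_))
    (ennreal_limsup_add_le _ _ _)
  dsimp only
  rw [← ENNReal.ofReal_add (by positivity) (by positivity), ← add_div]
  gcongr
  exact (abs_max_sub_max_le_max _ _ _ _).trans
    (max_le_add_of_nonneg (abs_nonneg _) (abs_nonneg _))

theorem measurable_lipConst [MeasurableSpace X] [BorelSpace X] {f : X → ℝ}
    (hf : Continuous f) : Measurable (lipConst f) := by
  have hlim : lipConst f = fun x => ⨅ n : ℕ, ⨆ y ∈ ball x (1 / ((n : ℝ) + 1)) ∩ {x}ᶜ,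
      ENNReal.ofReal (|f y - f x| / dist y x) := by
    ext x
    rw [lipConst, (nhdsWithin_hasBasis nhds_basis_ball_inv_nat_succ _).limsup_eq_iInf_iSup]
    simp
  rw [hlim]
  refine Measurable.iInf fun n => LowerSemicontinuous.measurable fun x a ha => ?_
  simp only [lt_iSup_iff] at ha
  obtain ⟨y, ⟨hyb, hyx⟩, hay⟩ := ha
  have hyx' : y ≠ x := hyx
  have hcont : ContinuousAt (fun z => ENNReal.ofReal (|f y - f z| / dist y z)) x := by
    refine ENNReal.continuous_ofReal.continuousAt.comp (ContinuousAt.div ?_ ?_ ?_)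
    · fun_prop
    · fun_prop
    · exact dist_ne_zero.2 hyx'
  filter_upwards [hcont.eventually (lt_mem_nhds hay),
    ball_mem_nhds x (sub_pos.2 (mem_ball.1 hyb)), isOpen_ne.mem_nhds hyx'.symm]
    with z hz hzb hzy
  refine hz.trans_le (le_iSup₂_of_le y ⟨?_, fun h => hzy h.symm⟩ le_rfl)
  rw [mem_ball] at hzb ⊢
  linarith [dist_triangle_right y z x]

variable [MeasurableSpace X] {μ : Measure X}

theorem perim_univ (E : Set X) :
    perim μ E univ = tvOpen μ (E.indicator fun _ => (1 : ℝ)) univ := by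
  refine le_antisymm (iInf_le_of_le univ (iInf₂_le_of_le isOpen_univ (subset_univ _) le_rfl)) ?_
  refine le_iInf fun Ω => le_iInf₂ fun _ h => ?_
  rw [univ_subset_iff.1 h]

theorem perim_mono (E : Set X) {A B : Set X} (h : A ⊆ B) : perim μ E A ≤ perim μ E B :=
  iInf_mono fun _ => iInf_mono fun _ => iInf_mono' fun hB => ⟨h.trans hB, le_rfl⟩

theorem tvOpen_le_of_forall_le {f : X → ℝ} {Ω : Set X} {fn : ℕ → X → ℝ} {a : ℝ≥0∞}
    (hlip : ∀ n, LocLipOn Ω (fn n)) (hlim : TendstoL1loc μ Ω fn f)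
    (ha : ∀ n, ∫⁻ x in Ω, lipConst (fn n) x ∂μ ≤ a) : tvOpen μ f Ω ≤ a :=
  (show tvOpen μ f Ω ≤ _ from sInf_le ⟨fn, hlip, hlim, rfl⟩).trans
    (liminf_le_of_le (by isBoundedDefault) fun b hb =>
      let ⟨n, hn⟩ := hb.exists
      hn.trans (ha n))

theorem exists_approx_of_tvOpen_lt {f : X → ℝ} {Ω : Set X} {a : ℝ≥0∞}
    (h : tvOpen μ f Ω < a) :
    ∃ fn : ℕ → X → ℝ, (∀ n, LocLipOn Ω (fn n)) ∧ TendstoL1loc μ Ω fn f ∧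
      ∀ n, ∫⁻ x in Ω, lipConst (fn n) x ∂μ ≤ a := by
  obtain ⟨_, ⟨fn, hlip, hlim, rfl⟩, hlt⟩ := sInf_lt_iff.1 h
  obtain ⟨φ, hφ, hφa⟩ := extraction_of_frequently_atTop
    (frequently_lt_of_liminf_lt (by isBoundedDefault) hlt)
  exact ⟨fun n => fn (φ n), fun n => hlip _,
    fun K hK hKΩ => (hlim K hK hKΩ).comp hφ.tendsto_atTop, fun n => (hφa n).le⟩

theorem perim_empty_univ : perim μ (∅ : Set X) univ = 0 := by
  rw [perim_univ, ← nonpos_iff_eq_zero]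
  refine tvOpen_le_of_forall_le (fn := fun _ _ => 0)
    (fun _ x _ => ⟨0, univ, univ_mem, LipschitzOnWith.of_dist_le_mul (by simp)⟩)
    (fun K _ _ => by simp) fun n => ?_
  have : lipConst (fun _ : X => (0 : ℝ)) = fun _ => 0 := by
    ext x
    refine le_antisymm (limsup_le_of_le (by isBoundedDefault) ?_) bot_le
    simp
  simp [this]

theorem finPerim_empty : FinPerim μ (∅ : Set X) :=
  ⟨MeasurableSet.empty, perim_empty_univ.trans_lt ENNReal.zero_lt_top⟩

theorem FinPerim.union [BorelSpace X] {E F : Set X} (hE : FinPerim μ E) (hF : FinPerim μ F) :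
    FinPerim μ (E ∪ F) := by
  refine ⟨hE.1.union hF.1, ?_⟩
  have hE' := hE.2
  have hF' := hF.2
  rw [perim_univ] at hE' hF' ⊢
  obtain ⟨a, hEa, ha⟩ := exists_between hE'
  obtain ⟨b, hFb, hb⟩ := exists_between hF'
  obtain ⟨f, hf, hfE, hfa⟩ := exists_approx_of_tvOpen_lt hEa
  obtain ⟨g, hg, hgF, hgb⟩ := exists_approx_of_tvOpen_lt hFb
  refine (tvOpen_le_of_forall_le (fn := fun n x => max (f n x) (g n x))
    (fun n => (hf n).max (hg n)) ?_ fun n => ?_).trans_lt (ENNReal.add_lt_top.2 ⟨ha, hb⟩)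
  · intro K hK hKΩ
    have hsum := (hfE K hK hKΩ).add (hgF K hK hKΩ)
    rw [add_zero] at hsum
    refine tendsto_of_tendsto_of_tendsto_of_le_of_le tendsto_const_nhds hsum
      (fun _ => zero_le) fun n => ?_
    dsimp only
    have hmeas : Measurable fun x =>
        ENNReal.ofReal |f n x - E.indicator (fun _ => (1 : ℝ)) x| :=
      ENNReal.measurable_ofReal.comp (measurable_norm.comp
        ((hf n).continuous.measurable.sub (measurable_const.indicator hE.1)))
    rw [← lintegral_add_left hmeas]
    refine lintegral_mono fun x => ?_
    rw [← ENNReal.ofReal_add (abs_nonneg _) (abs_nonneg _)]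
    refine ENNReal.ofReal_le_ofReal ?_
    have hmax : (E ∪ F).indicator (fun _ => (1 : ℝ)) x =
        max (E.indicator (fun _ => (1 : ℝ)) x) (F.indicator (fun _ => (1 : ℝ)) x) := by
      by_cases hxE : x ∈ E <;> by_cases hxF : x ∈ F <;> simp [hxE, hxF]
    rw [hmax]
    exact (abs_max_sub_max_le_max _ _ _ _).trans
      (max_le_add_of_nonneg (abs_nonneg _) (abs_nonneg _))
  · refine (lintegral_mono fun x => lipConst_max_le (f n) (g n) x).trans ?_
    rw [lintegral_add_left (measurable_lipConst (hf n).continuous)]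
    exact add_le_add (hfa n) (hgb n)

theorem PerimRepr.codimH_empty {θ : Set X → X → ℝ≥0∞} (h : PerimRepr μ θ) :
    codimH μ ∅ = 0 := by
  obtain ⟨γ, C, -, -, hrep⟩ := h
  have h0 := (hrep ∅ finPerim_empty).2 univ MeasurableSet.univ
  rw [perim_empty_univ] at h0
  have hle : ∫⁻ _ in Ioi (0 : ℝ), codimH μ ∅ ≤ 0 :=
    (lintegral_mono fun t => codimH_mono (empty_subset _)).trans h0.ge
  simpa using hle

end Perimeter

variable {X : Type*} [MetricSpace X] [CompleteSpace X] [TopologicalSpace.SeparableSpace X]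
  [MeasurableSpace X] [BorelSpace X]

/-- Additivity of the perimeter vs. essential boundaries. -/
theorem perim_additive_iff_essBdry
    (μ : Measure X) [IsLocallyFiniteMeasure μ] (hμ : μ ≠ 0)
    (hPI : IsPI μ) (hIso : Isotropic μ)
    (E F B : Set X) (hE : FinPerim μ E) (hF : FinPerim μ F) (hB : MeasurableSet B) :
    (perim μ (E ∪ F) B = perim μ E B + perim μ F B →
      codimH μ (essBdry μ E ∩ essBdry μ F ∩ B) = 0) ∧
    (μ (E ∩ F) = 0 → codimH μ (essBdry μ E ∩ essBdry μ F ∩ B) = 0 →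
      perim μ (E ∪ F) B = perim μ E B + perim μ F B) := by
  obtain ⟨CD, _, _, hD, -⟩ := hPI
  obtain ⟨θ, hrepr, hθ⟩ := hIso
  have h0 := hrepr.codimH_empty
  obtain ⟨γ, C, hγ, -, hrep⟩ := hrepr
  have hG := hE.union hF
  let ν := codimHOuter μ h0
  have hsplit (S : Set X) (f : X → ℝ≥0∞) : outerLint (codimH μ) S f =
      outerLint (codimH μ) (S ∩ essBdry μ E) f + outerLint (codimH μ) (S \ essBdry μ E) f :=
    outerLint_inter_add_diff ν
      (codimH_inter_add_diff h0 (measurableSet_essBdry hD hμ E)) S f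
  have hGE : ν {x ∈ essBdry μ E ∩ essBdry μ (E ∪ F) | θ E x ≠ θ (E ∪ F) x} = 0 :=
    hθ _ _ hG hE subset_union_left
  have hGF : ν {x ∈ essBdry μ F ∩ essBdry μ (E ∪ F) | θ F x ≠ θ (E ∪ F) x} = 0 :=
    hθ _ _ hG hF subset_union_right
  have hGle : outerLint (codimH μ) (B ∩ essBdry μ (E ∪ F)) (θ (E ∪ F)) ≤
      outerLint (codimH μ) (B ∩ essBdry μ E) (θ E) +
        outerLint (codimH μ) ((B ∩ essBdry μ F) \ essBdry μ E) (θ F) := by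
    rw [hsplit]
    refine add_le_add (outerLint_le_of_null_diff ν (measure_mono_null ?_ hGE))
      (outerLint_le_of_null_diff ν (measure_mono_null ?_ hGF))
    · rintro x ⟨⟨⟨hxB, hxG⟩, hxE⟩, hx⟩
      exact ⟨⟨hxE, hxG⟩, fun h => hx ⟨⟨hxB, hxE⟩, h.symm⟩⟩
    · rintro x ⟨⟨⟨hxB, hxG⟩, hxE⟩, hx⟩
      have hxF := (essBdry_union_subset E F hxG).resolve_left hxE
      exact ⟨⟨hxF, hxG⟩, fun h => hx ⟨⟨⟨hxB, hxF⟩, hxE⟩, h.symm⟩⟩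
  constructor
  · intro hadd
    have hEfin : perim μ E B ≠ ⊤ := ((perim_mono E (subset_univ B)).trans_lt hE.2).ne
    have hFfin : perim μ F B ≠ ⊤ := ((perim_mono F (subset_univ B)).trans_lt hF.2).ne
    rw [← (hrep _ hG).2 B hB, ← (hrep _ hE).2 B hB, hadd,
      ENNReal.add_le_add_iff_left hEfin] at hGle
    have hFsplit := hsplit (B ∩ essBdry μ F) (θ F)
    rw [← (hrep _ hF).2 B hB] at hFsplit
    have hdfin : outerLint (codimH μ) ((B ∩ essBdry μ F) \ essBdry μ E) (θ F) ≠ ⊤ :=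
      ne_top_of_le_ne_top hFfin (hFsplit ▸ le_add_self)
    have hzero : outerLint (codimH μ) (B ∩ essBdry μ F ∩ essBdry μ E) (θ F) = 0 := by
      rw [hFsplit] at hGle
      exact nonpos_iff_eq_zero.1
        ((ENNReal.add_le_add_iff_right hdfin).1 (by rwa [zero_add]))
    have hN := eq_zero_of_outerLint_eq_zero (codimH μ) hγ
      (fun x hx => ((hrep _ hF).1 x hx.1.2).1) hzero
    rwa [show essBdry μ E ∩ essBdry μ F ∩ B = B ∩ essBdry μ F ∩ essBdry μ E by
      rw [inter_comm, inter_comm (essBdry μ E), inter_assoc]]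
  · intro hEF hN
    replace hN : ν (essBdry μ E ∩ essBdry μ F ∩ B) = 0 := hN
    have hFE : μ (F ∩ E) = 0 := by rwa [inter_comm]
    rw [(hrep _ hG).2 B hB, (hrep _ hE).2 B hB, (hrep _ hF).2 B hB]
    refine le_antisymm (hGle.trans ?_) ?_
    · gcongr
      refine outerLint_le_of_null_diff ν (measure_mono_null ?_ hN)
      rintro x ⟨hx, hx'⟩
      exact (hx' ⟨hx.1, rfl⟩).elim
    · rw [hsplit (B ∩ essBdry μ (E ∪ F))]
      refine add_le_add
        (outerLint_le_of_null_diff ν (measure_mono_null ?_ (measure_union_null hN hGE)))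
        (outerLint_le_of_null_diff ν (measure_mono_null ?_ (measure_union_null hN hGF)))
      · rintro x ⟨⟨hxB, hxE⟩, hx⟩
        by_cases hxF : x ∈ essBdry μ F
        · exact Or.inl ⟨⟨hxE, hxF⟩, hxB⟩
        · have hxG := essBdry_diff_subset_essBdry_union hEF ⟨hxE, hxF⟩
          exact Or.inr ⟨⟨hxE, hxG⟩, fun h => hx ⟨⟨⟨hxB, hxG⟩, hxE⟩, h⟩⟩
      · rintro x ⟨⟨hxB, hxF⟩, hx⟩
        by_cases hxE : x ∈ essBdry μ E
        · exact Or.inl ⟨⟨hxE, hxF⟩, hxB⟩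
        · have hxG : x ∈ essBdry μ (E ∪ F) :=
            union_comm F E ▸ essBdry_diff_subset_essBdry_union hFE ⟨hxF, hxE⟩
          exact Or.inr ⟨⟨hxF, hxG⟩, fun h => hx ⟨⟨⟨hxB, hxG⟩, hxE⟩, h⟩⟩

end PaperBV
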